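/- arXiv:1405.1744 — 2 statements merged into one kernel-verified Lean document; each statement's English description precedes it below -/
import Mathlib

section
/- Let S₁ and S₂ be symmetric real n×n matrices that commute and satisfy 0 ≼ Sᵢ ≼ Iₙ for i = 1, 2. Then M_μ(S₁) + M_μ(S₂) ≥ d²(S₁, S₂), i.e., μᵀ[(Iₙ−S₁)² + (Iₙ−S₂)²]μ + σ²·tr(S₁² + S₂²) ≥ μᵀ(S₁−S₂)²μ + σ²·tr((S₁−S₂)²). -/
open Matrix

open scoped MatrixOrder in
lemma posSemidef_mul_aux {n : ℕ} {A B : Matrix (Fin n) (Fin n) ℝ}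
    (hA : A.PosSemidef) (hB : B.PosSemidef) (h : A * B = B * A) : (A * B).PosSemidef :=
  Matrix.nonneg_iff_posSemidef.1
    (Commute.mul_nonneg (Matrix.nonneg_iff_posSemidef.2 hA) (Matrix.nonneg_iff_posSemidef.2 hB) h)

/-- With `M_μ(S) := μᵀ(I−S)²μ + σ²·tr(S²)` and
`d²(S₁,S₂) := μᵀ(S₁−S₂)²μ + σ²·tr((S₁−S₂)²)`: if `S₁, S₂` are symmetric,
commuting, and `0 ≼ Sᵢ ≼ I`, then `M_μ(S₁) + M_μ(S₂) ≥ d²(S₁,S₂)`. -/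
theorem Mmu_sum_ge_dSq {n : ℕ} (μ : Fin n → ℝ) (σ : ℝ) (hσ : 0 < σ)
    (S₁ S₂ : Matrix (Fin n) (Fin n) ℝ)
    (h₁ : S₁.PosSemidef) (h₁' : (1 - S₁).PosSemidef)
    (h₂ : S₂.PosSemidef) (h₂' : (1 - S₂).PosSemidef)
    (hcomm : S₁ * S₂ = S₂ * S₁) :
    μ ⬝ᵥ ((1 - S₁) ^ 2 + (1 - S₂) ^ 2).mulVec μ + σ ^ 2 * (S₁ ^ 2 + S₂ ^ 2).trace ≥
      μ ⬝ᵥ ((S₁ - S₂) ^ 2).mulVec μ + σ ^ 2 * ((S₁ - S₂) ^ 2).trace := by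
  have hc' : (1 - S₁) * (1 - S₂) = (1 - S₂) * (1 - S₁) := by
    simp only [mul_sub, sub_mul, mul_one, one_mul, hcomm]; abel
  have hP := posSemidef_mul_aux h₁ h₂ hcomm
  have hQ := posSemidef_mul_aux h₁' h₂' hc'
  have e1 : (1 - S₁) ^ 2 + (1 - S₂) ^ 2 = (S₁ - S₂) ^ 2
      + ((1 - S₁) * (1 - S₂) + (1 - S₁) * (1 - S₂)) := by
    simp only [pow_two, mul_sub, sub_mul, mul_one, one_mul, hcomm]; abel
  have e2 : S₁ ^ 2 + S₂ ^ 2 = (S₁ - S₂) ^ 2 + (S₁ * S₂ + S₁ * S₂) := by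
    simp only [pow_two, mul_sub, sub_mul, hcomm]; abel
  have q := hQ.dotProduct_mulVec_nonneg μ
  have t := mul_nonneg (sq_nonneg σ) hP.trace_nonneg
  rw [star_trivial] at q
  rw [e1, e2]
  simp only [Matrix.add_mulVec, dotProduct_add, Matrix.trace_add]
  linarith
end

section
/- Let S and S_μ be symmetric real n×n matrices that commute and satisfy 0 ≼ S ≼ Iₙ and 0 ≼ S_μ ≼ Iₙ, and set m* := M_μ(S_μ). If d²(S, S_μ) ≥ 3m*, then M_μ(S) − m* ≥ (1/3)·d²(S, S_μ). -/
open Matrix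

/-- `M_μ(S) := μᵀ(I−S)²μ + σ²·tr(S²)`. -/
noncomputable def Mmu {n : ℕ} (μ : Fin n → ℝ) (σ : ℝ)
    (S : Matrix (Fin n) (Fin n) ℝ) : ℝ :=
  μ ⬝ᵥ ((1 - S) ^ 2).mulVec μ + σ ^ 2 * (S ^ 2).trace

/-- `d²(S₁,S₂) := μᵀ(S₁−S₂)²μ + σ²·tr((S₁−S₂)²)`. -/
noncomputable def dSq {n : ℕ} (μ : Fin n → ℝ) (σ : ℝ)
    (S₁ S₂ : Matrix (Fin n) (Fin n) ℝ) : ℝ :=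
  μ ⬝ᵥ ((S₁ - S₂) ^ 2).mulVec μ + σ ^ 2 * ((S₁ - S₂) ^ 2).trace

open scoped MatrixOrder Matrix.Norms.L2Operator in
theorem aux_mul_psd {n : ℕ} (A B : Matrix (Fin n) (Fin n) ℝ)
    (hA : A.PosSemidef) (hB : B.PosSemidef) (h : A * B = B * A) : (A * B).PosSemidef :=
  Matrix.nonneg_iff_posSemidef.1
    (Commute.mul_nonneg (Matrix.nonneg_iff_posSemidef.2 hA) (Matrix.nonneg_iff_posSemidef.2 hB) h)

theorem Mmu_growth {n : ℕ} (μ : Fin n → ℝ) (σ : ℝ) (hσ : 0 < σ)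
    (S Sμ : Matrix (Fin n) (Fin n) ℝ)
    (hS : S.PosSemidef) (hS' : (1 - S).PosSemidef)
    (hSμ : Sμ.PosSemidef) (hSμ' : (1 - Sμ).PosSemidef)
    (hcomm : S * Sμ = Sμ * S)
    (hfar : dSq μ σ S Sμ ≥ 3 * Mmu μ σ Sμ) :
    Mmu μ σ S - Mmu μ σ Sμ ≥ (1 / 3) * dSq μ σ S Sμ := by
  have h1 := aux_mul_psd S Sμ hS hSμ hcomm
  have h2 := aux_mul_psd (1 - S) (1 - Sμ) hS' hSμ' (by
    simp only [sub_mul, mul_sub, one_mul, mul_one, hcomm]; abel)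
  have t1 : 0 ≤ (S * Sμ).trace := h1.trace_nonneg
  have t2 : 0 ≤ μ ⬝ᵥ ((1 - S) * (1 - Sμ)).mulVec μ := by
    simpa using h2.dotProduct_mulVec_nonneg μ
  have e1 : (S - Sμ) ^ 2 = S ^ 2 + Sμ ^ 2 - (2 : ℝ) • (S * Sμ) := by
    rw [two_smul]
    simp only [pow_two, sub_mul, mul_sub, hcomm]; abel
  have e2 : (S - Sμ) ^ 2 = (1 - S) ^ 2 + (1 - Sμ) ^ 2 - (2 : ℝ) • ((1 - S) * (1 - Sμ)) := by
    rw [two_smul]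
    simp only [pow_two, sub_mul, mul_sub, one_mul, mul_one, hcomm]; abel
  have key : Mmu μ σ S + Mmu μ σ Sμ - dSq μ σ S Sμ
      = 2 * (μ ⬝ᵥ ((1 - S) * (1 - Sμ)).mulVec μ) + 2 * (σ ^ 2 * (S * Sμ).trace) := by
    have f1 := congrArg Matrix.trace e1
    have f2 := congrArg (fun X => μ ⬝ᵥ X.mulVec μ) e2
    simp only [Matrix.trace_sub, Matrix.trace_add, Matrix.trace_smul, smul_eq_mul] at f1
    simp only [Matrix.sub_mulVec, Matrix.add_mulVec, Matrix.smul_mulVec, dotProduct_sub,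
      dotProduct_add, dotProduct_smul, smul_eq_mul] at f2
    unfold Mmu dSq
    simp only [Matrix.sub_mulVec, Matrix.add_mulVec, Matrix.smul_mulVec, dotProduct_sub,
      dotProduct_add, dotProduct_smul, smul_eq_mul, f1, f2]
    ring
  have t3 : 0 ≤ σ ^ 2 * (S * Sμ).trace := mul_nonneg (sq_nonneg _) t1
  linarith
end
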